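/- Let 0 ≤ λ < 1 and 1 < p, q < ∞ satisfy 1/p + 1/q + λ = 2. Then there exists a constant C > 0 (depending only on λ, p, q) such that for all measurable functions g, h on (−π/2, π/2), ∫_{−π/2}^{π/2} ∫_{−π/2}^{π/2} |g(t)| |h(τ)| / |sin(t − τ)|^λ dt dτ ≤ C ‖g‖_{L^p(−π/2, π/2)} ‖h‖_{L^q(−π/2, π/2)}. -/

import Mathlib

open MeasureTheory Real Set


namespace HLS
lemma fold (G : ℝ → ENNReal) (hG : Measurable G) (c : ℝ) :
    ∫⁻ y, G |y - c| = 2 * ∫⁻ y in Ioi 0, G y := by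
  rw [lintegral_sub_right_eq_self (fun y => G |y|) c]
  rw [← lintegral_add_compl (fun y => G |y|) (measurableSet_Ioi (a := (0:ℝ))), two_mul]
  congr 1
  · exact setLIntegral_congr_fun measurableSet_Ioi (fun x hx => by simp [abs_of_pos (mem_Ioi.1 hx)])
  · rw [compl_Ioi, setLIntegral_congr Iio_ae_eq_Iic.symm]
    rw [← lintegral_indicator measurableSet_Iio, ← lintegral_indicator measurableSet_Ioi,
      ← lintegral_neg_eq_self]
    congr 1; ext x
    by_cases hx : 0 < x
    · simp [indicator, hx, abs_of_pos hx]
    · simp [indicator, hx]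

lemma near (lam : ℝ) (h1 : lam < 1) (δ : ℝ) (hδ : 0 < δ) (c : ℝ) :
    ∫⁻ y, (if |y - c| ≤ δ then ENNReal.ofReal (|y - c| ^ (-lam)) else 0)
      = ENNReal.ofReal (2 / (1 - lam) * δ ^ (1 - lam)) := by
  have hm : Measurable (fun z : ℝ => if z ≤ δ then ENNReal.ofReal (z ^ (-lam)) else 0) :=
    Measurable.ite measurableSet_Iic (by fun_prop) (by fun_prop)
  rw [fold _ hm]
  have : ∫⁻ z in Ioi 0, (if z ≤ δ then ENNReal.ofReal (z ^ (-lam)) else 0)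
      = ∫⁻ z in Ioc 0 δ, ENNReal.ofReal (z ^ (-lam)) := by
    rw [← lintegral_indicator measurableSet_Ioi, ← lintegral_indicator measurableSet_Ioc]
    congr 1; ext z
    simp only [indicator, mem_Ioi, mem_Ioc]
    split_ifs <;> simp_all
  have hi : IntervalIntegrable (fun z : ℝ => z ^ (-lam)) volume 0 δ :=
    intervalIntegral.intervalIntegrable_rpow' (by linarith)
  rw [this, ← ofReal_integral_eq_lintegral_ofReal]
  · rw [← intervalIntegral.integral_of_le hδ.le, integral_rpow (Or.inl (by linarith)),
      Real.zero_rpow (by linarith), show (2 : ENNReal) = ENNReal.ofReal 2 by simp,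
      ← ENNReal.ofReal_mul (by norm_num)]
    congr 1
    rw [show -lam + 1 = 1 - lam by ring]; ring
  · exact (intervalIntegrable_iff_integrableOn_Ioc_of_le hδ.le).1 hi
  · filter_upwards [ae_restrict_mem measurableSet_Ioc] with z hz
    exact Real.rpow_nonneg hz.1.le _

lemma far (a : ℝ) (h1 : 1 < a) (δ : ℝ) (hδ : 0 < δ) (c : ℝ) :
    ∫⁻ y, (if |y - c| ≤ δ then 0 else ENNReal.ofReal (|y - c| ^ (-a)))
      = ENNReal.ofReal (2 / (a - 1) * δ ^ (1 - a)) := by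
  have hm : Measurable (fun z : ℝ => if z ≤ δ then 0 else ENNReal.ofReal (z ^ (-a))) :=
    Measurable.ite measurableSet_Iic (by fun_prop) (by fun_prop)
  rw [fold _ hm]
  have : ∫⁻ z in Ioi 0, (if z ≤ δ then 0 else ENNReal.ofReal (z ^ (-a)))
      = ∫⁻ z in Ioi δ, ENNReal.ofReal (z ^ (-a)) := by
    rw [← lintegral_indicator measurableSet_Ioi, ← lintegral_indicator measurableSet_Ioi]
    congr 1; ext z
    simp only [indicator, mem_Ioi]
    split_ifs <;> first | rfl | (exfalso; linarith)
  rw [this, ← ofReal_integral_eq_lintegral_ofReal]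
  · rw [integral_Ioi_rpow_of_lt (by linarith) hδ, show (2 : ENNReal) = ENNReal.ofReal 2 by simp,
      ← ENNReal.ofReal_mul (by norm_num)]
    congr 1
    rw [show -a + 1 = 1 - a by ring]
    have : 1 - a ≠ 0 := by linarith
    have : a - 1 ≠ 0 := by linarith
    field_simp; ring
  · exact integrableOn_Ioi_rpow_of_lt (by linarith) hδ
  · filter_upwards [ae_restrict_mem measurableSet_Ioi] with z hz
    exact Real.rpow_nonneg (hδ.le.trans (le_of_lt hz)) _

lemma inner_bound (lam q : ℝ) (h0 : 0 < lam) (h1 : lam < 1) (hq : 1 < q) (hl : 1 - 1 / q < lam) :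
    ∃ C : ℝ, 0 < C ∧ ∀ h : ℝ → ENNReal, Measurable h → (∫⁻ y, h y ^ q) ≤ 1 → ∀ c m : ℝ, 0 < m →
      ∫⁻ y, (if h y ≤ ENNReal.ofReal m then h y else 0) * ENNReal.ofReal (|y - c| ^ (-lam))
        ≤ ENNReal.ofReal (C * m ^ (1 - q + q * lam)) := by
  set q' := q / (q - 1) with hq'
  have hq1 : 0 < q - 1 := by linarith
  have hq'0 : 0 < q' := by positivity
  have hinv : 1 / q' = 1 - 1 / q := by rw [hq']; field_simp
  have hconj : q.HolderConjugate q' := by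
    rw [Real.holderConjugate_iff]; refine ⟨hq, ?_⟩
    have := hinv; simp only [one_div] at this; rw [this]; ring
  have ha : 1 < lam * q' := by
    have : 1 / q' < lam := by rw [hinv]; exact hl
    rwa [div_lt_iff₀ hq'0] at this
  refine ⟨2 / (1 - lam) + (2 / (lam * q' - 1)) ^ (1 / q'), ?_, ?_⟩
  · have : 0 < 1 - lam := by linarith
    have : 0 < lam * q' - 1 := by linarith
    positivity
  intro h hh hn c m hm
  set δ := m ^ (-q) with hδ
  have hδ0 : 0 < δ := by positivity
  set N : ℝ → ENNReal := fun y => if |y - c| ≤ δ then ENNReal.ofReal (|y - c| ^ (-lam)) else 0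
  set F : ℝ → ENNReal := fun y => if |y - c| ≤ δ then 0 else ENNReal.ofReal (|y - c| ^ (-lam))
  have hNm : Measurable N := Measurable.ite (measurableSet_le (by fun_prop) (by fun_prop)) (by fun_prop) (by fun_prop)
  have hFm : Measurable F := Measurable.ite (measurableSet_le (by fun_prop) (by fun_prop)) (by fun_prop) (by fun_prop)
  have hF : ∫⁻ y, F y ^ q' = ENNReal.ofReal (2 / (lam * q' - 1) * δ ^ (1 - lam * q')) := by
    rw [← far (lam * q') ha δ hδ0 c]
    congr 1; ext y
    simp only [F]
    split_ifs
    · exact ENNReal.zero_rpow_of_pos hq'0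
    · rw [ENNReal.ofReal_rpow_of_nonneg (by positivity) hq'0.le, ← Real.rpow_mul (abs_nonneg _)]
      congr 2; ring
  calc ∫⁻ y, (if h y ≤ ENNReal.ofReal m then h y else 0) * ENNReal.ofReal (|y - c| ^ (-lam))
      ≤ ∫⁻ y, (ENNReal.ofReal m * N y + h y * F y) := by
        refine lintegral_mono fun y => ?_
        simp only [N, F]
        split_ifs with a b b
        · simp; gcongr
        · simp
        · simp
        · simp
    _ = ENNReal.ofReal m * (∫⁻ y, N y) + ∫⁻ y, h y * F y := by
        rw [lintegral_add_left (by fun_prop), lintegral_const_mul _ hNm]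
    _ ≤ ENNReal.ofReal m * (∫⁻ y, N y) + (∫⁻ y, h y ^ q) ^ (1 / q) * (∫⁻ y, F y ^ q') ^ (1 / q') := by
        gcongr
        exact ENNReal.lintegral_mul_le_Lp_mul_Lq volume hconj hh.aemeasurable hFm.aemeasurable
    _ ≤ ENNReal.ofReal m * (∫⁻ y, N y) + 1 * (∫⁻ y, F y ^ q') ^ (1 / q') := by
        gcongr
        exact ENNReal.rpow_le_one hn (by positivity)
    _ = _ := by
        have e1 : 0 < 1 - lam := by linarith
        have e2 : 0 < lam * q' - 1 := by linarith
        rw [hF, near lam h1 δ hδ0 c, one_mul, ENNReal.ofReal_rpow_of_nonneg (by positivity) (by positivity),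
          ← ENNReal.ofReal_mul hm.le, ← ENNReal.ofReal_add (by positivity) (by positivity)]
        congr 1
        rw [Real.mul_rpow (by positivity) (by positivity), add_mul, ← Real.rpow_mul hδ0.le, hδ,
          ← Real.rpow_mul hm.le, ← Real.rpow_mul hm.le]
        have x1 : -q * ((1 - lam * q') * (1 / q')) = 1 - q + q * lam := by
          have : (1 - lam * q') * (1 / q') = 1 / q' - lam := by field_simp
          rw [this, hinv]; field_simp; ring
        have x2 : m * m ^ (-q * (1 - lam)) = m ^ (1 - q + q * lam) := by
          conv_lhs => rw [← Real.rpow_one m]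
          rw [← Real.rpow_mul hm.le, ← Real.rpow_add hm]; congr 1; ring
        rw [x1, ← x2]; ring

/-- Half of the bilinear estimate: the part where `h` is dominated by `f`. -/
lemma half (lam p q : ℝ) (h0 : 0 < lam) (h1 : lam < 1) (hp : 1 < p) (hq : 1 < q)
    (hpq : 1 / p + 1 / q + lam = 2) :
    ∃ C : ℝ, 0 < C ∧ ∀ f h : ℝ → ENNReal, Measurable f → Measurable h → (∀ x, f x ≠ ⊤) →
      (∫⁻ y, f y ^ p) ≤ 1 → (∫⁻ y, h y ^ q) ≤ 1 → ∀ s : ℝ,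
      ∫⁻ x, ∫⁻ y, f x * ((if h y ≤ f x ^ (p / q) then h y else 0) * ENNReal.ofReal (|y - (x - s)| ^ (-lam)))
        ≤ ENNReal.ofReal C := by
  have hp1 : 1 / p < 1 := by rw [div_lt_one (by linarith)]; exact hp
  obtain ⟨C, hC, H⟩ := inner_bound lam q h0 h1 hq (by linarith)
  refine ⟨C, hC, fun f h hf hh hft hfn hhn s => ?_⟩
  calc _ ≤ ∫⁻ x, ENNReal.ofReal C * f x ^ p := by
        refine lintegral_mono fun x => ?_
        simp only
        rw [lintegral_const_mul' _ _ (hft x)]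
        rcases eq_or_ne (f x) 0 with h00 | h00
        · simp [h00]
        have hr : 0 < (f x).toReal := ENNReal.toReal_pos h00 (hft x)
        have hfx : f x = ENNReal.ofReal (f x).toReal := (ENNReal.ofReal_toReal (hft x)).symm
        set r := (f x).toReal
        rw [hfx, ENNReal.ofReal_rpow_of_pos hr, ENNReal.ofReal_rpow_of_pos hr]
        refine (mul_le_mul_right (H h hh hhn (x - s) (r ^ (p / q)) (by positivity)) _).trans ?_
        rw [← ENNReal.ofReal_mul hr.le, ← ENNReal.ofReal_mul hC.le, ← Real.rpow_mul hr.le]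
        have : p / q * (1 - q + q * lam) = p - 1 := by
          have : lam = 2 - 1 / p - 1 / q := by linarith
          rw [this]; field_simp; ring
        rw [this]
        have : r ^ p = r * r ^ (p - 1) := by
          conv_rhs => rw [← Real.rpow_one r]
          rw [← Real.rpow_mul hr.le, ← Real.rpow_add hr]; congr 1; ring
        rw [this]
        apply le_of_eq; congr 1; ring
    _ = ENNReal.ofReal C * ∫⁻ x, f x ^ p := lintegral_const_mul _ (by fun_prop)
    _ ≤ ENNReal.ofReal C * 1 := by gcongr
    _ = _ := mul_one _

lemma normalized (lam p q : ℝ) (h0 : 0 < lam) (h1 : lam < 1) (hp : 1 < p) (hq : 1 < q)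
    (hpq : 1 / p + 1 / q + lam = 2) :
    ∃ C : ℝ, 0 < C ∧ ∀ f h : ℝ → ENNReal, Measurable f → Measurable h → (∀ x, f x ≠ ⊤) →
      (∀ x, h x ≠ ⊤) →
      (∫⁻ y, f y ^ p) ≤ 1 → (∫⁻ y, h y ^ q) ≤ 1 → ∀ s : ℝ,
      ∫⁻ x, ∫⁻ y, f x * h y * ENNReal.ofReal (|x - y - s| ^ (-lam))
        ≤ ENNReal.ofReal C := by
  obtain ⟨C1, hC1, H1⟩ := half lam p q h0 h1 hp hq hpq
  obtain ⟨C2, hC2, H2⟩ := half lam q p h0 h1 hq hp (by linarith)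
  refine ⟨C1 + C2, by positivity, fun f h hf hh hft hht hfn hhn s => ?_⟩
  have K1 := H1 f h hf hh hft hfn hhn s
  have K2 := H2 h f hh hf hht hhn hfn (-s)
  have hm1 : Measurable (fun z : ℝ × ℝ => f z.1 * ((if h z.2 ≤ f z.1 ^ (p / q) then h z.2 else 0) * ENNReal.ofReal (|z.2 - (z.1 - s)| ^ (-lam)))) := by
    have : Measurable (fun z : ℝ × ℝ => if h z.2 ≤ f z.1 ^ (p / q) then h z.2 else 0) :=
      Measurable.ite (measurableSet_le (by fun_prop) (by fun_prop)) (by fun_prop) (by fun_prop)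
    fun_prop
  have hm2 : Measurable (fun z : ℝ × ℝ => h z.1 * ((if f z.2 ≤ h z.1 ^ (q / p) then f z.2 else 0) * ENNReal.ofReal (|z.2 - (z.1 - -s)| ^ (-lam)))) := by
    have : Measurable (fun z : ℝ × ℝ => if f z.2 ≤ h z.1 ^ (q / p) then f z.2 else 0) :=
      Measurable.ite (measurableSet_le (by fun_prop) (by fun_prop)) (by fun_prop) (by fun_prop)
    fun_prop
  rw [lintegral_lintegral_swap hm2.aemeasurable] at K2
  rw [ENNReal.ofReal_add hC1.le hC2.le]
  refine le_trans ?_ (add_le_add K1 K2)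
  rw [← lintegral_add_left hm1.lintegral_prod_right']
  refine lintegral_mono fun x => ?_
  simp only
  have hmx : Measurable (fun y : ℝ => f x * ((if h y ≤ f x ^ (p / q) then h y else 0) *
      ENNReal.ofReal (|y - (x - s)| ^ (-lam)))) := hm1.comp measurable_prodMk_left
  rw [← lintegral_add_left hmx]
  refine lintegral_mono fun y => ?_
  simp only
  have a1 : |y - (x - s)| = |x - y - s| := by rw [← abs_neg]; congr 1; ring
  have a2 : |x - (y - -s)| = |x - y - s| := by congr 1; ring
  rw [a1, a2]
  by_cases hc : h y ≤ f x ^ (p / q)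
  · rw [if_pos hc, mul_assoc]; exact le_self_add
  · have : f x ≤ h y ^ (q / p) := by
      have := ENNReal.rpow_le_rpow (not_le.1 hc).le (z := q / p) (by positivity)
      rwa [← ENNReal.rpow_mul, show p / q * (q / p) = 1 by field_simp, ENNReal.rpow_one] at this
    rw [if_pos this, mul_comm (f x) (h y), mul_assoc]; exact le_add_self

lemma general (lam p q : ℝ) (h0 : 0 < lam) (h1 : lam < 1) (hp : 1 < p) (hq : 1 < q)
    (hpq : 1 / p + 1 / q + lam = 2) :
    ∃ C : ℝ, 0 < C ∧ ∀ f h : ℝ → ENNReal, Measurable f → Measurable h → (∀ x, f x ≠ ⊤) →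
      (∀ x, h x ≠ ⊤) → ∀ s : ℝ,
      ∫⁻ x, ∫⁻ y, f x * h y * ENNReal.ofReal (|x - y - s| ^ (-lam))
        ≤ ENNReal.ofReal C * (∫⁻ y, f y ^ p) ^ (1 / p) * (∫⁻ y, h y ^ q) ^ (1 / q) := by
  obtain ⟨C, hC, H⟩ := normalized lam p q h0 h1 hp hq hpq
  refine ⟨C, hC, fun f h hf hh hft hht s => ?_⟩
  have hp0 : 0 < p := by linarith
  have hq0 : 0 < q := by linarith
  set A := (∫⁻ y, f y ^ p) ^ (1 / p) with hA
  set B := (∫⁻ y, h y ^ q) ^ (1 / q) with hB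
  rcases eq_or_ne A 0 with hA0 | hA0
  · have : ∀ᵐ x, f x = 0 := by
      rw [hA, ENNReal.rpow_eq_zero_iff_of_pos (by positivity), lintegral_eq_zero_iff (by fun_prop)] at hA0
      filter_upwards [hA0] with x hx
      exact (ENNReal.rpow_eq_zero_iff_of_pos hp0).1 hx
    have : ∫⁻ x, ∫⁻ y, f x * h y * ENNReal.ofReal (|x - y - s| ^ (-lam)) = ∫⁻ x : ℝ, 0 := by
      refine lintegral_congr_ae ?_
      filter_upwards [this] with x hx
      simp [hx]
    simp [this]
  rcases eq_or_ne B 0 with hB0 | hB0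
  · have : ∀ᵐ x, h x = 0 := by
      rw [hB, ENNReal.rpow_eq_zero_iff_of_pos (by positivity), lintegral_eq_zero_iff (by fun_prop)] at hB0
      filter_upwards [hB0] with x hx
      exact (ENNReal.rpow_eq_zero_iff_of_pos hq0).1 hx
    have : ∀ x, ∫⁻ y, f x * h y * ENNReal.ofReal (|x - y - s| ^ (-lam)) = ∫⁻ x : ℝ, 0 := by
      intro x
      refine lintegral_congr_ae ?_
      filter_upwards [this] with x hx
      simp [hx]
    simp [this]
  have hCne : ENNReal.ofReal C ≠ 0 := by simpa using hC
  rcases eq_or_ne A ⊤ with hAt | hAt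
  · simp [hAt, hCne, hB0, ENNReal.mul_top, ENNReal.top_mul]
  rcases eq_or_ne B ⊤ with hBt | hBt
  · rw [hBt, ENNReal.mul_top (mul_ne_zero hCne hA0)]; exact le_top
  have nrm : ∀ (u : ℝ → ENNReal) (r : ℝ) (D : ENNReal), Measurable u → 0 < r → D = (∫⁻ y, u y ^ r) ^ (1 / r) →
      D ≠ 0 → D ≠ ⊤ → ∫⁻ y, (D⁻¹ * u y) ^ r ≤ 1 := by
    intro u r D hu hr hD hD0 hDt
    have : ∫⁻ y, u y ^ r = D ^ r := by
      rw [hD, ← ENNReal.rpow_mul, one_div_mul_cancel hr.ne', ENNReal.rpow_one]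
    simp_rw [ENNReal.mul_rpow_of_nonneg _ _ hr.le]
    rw [lintegral_const_mul _ (by fun_prop), this, ← ENNReal.mul_rpow_of_nonneg _ _ hr.le,
      ENNReal.inv_mul_cancel hD0 hDt, ENNReal.one_rpow]
  have K := H (fun x => A⁻¹ * f x) (fun x => B⁻¹ * h x) (by fun_prop) (by fun_prop)
    (fun x => ENNReal.mul_ne_top (ENNReal.inv_ne_top.2 hA0) (hft x))
    (fun x => ENNReal.mul_ne_top (ENNReal.inv_ne_top.2 hB0) (hht x))
    (nrm f p A hf hp0 hA hA0 hAt) (nrm h q B hh hq0 hB hB0 hBt) s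
  have E : ∀ x y, f x * h y * ENNReal.ofReal (|x - y - s| ^ (-lam))
      = (A * B) * (A⁻¹ * f x * (B⁻¹ * h y) * ENNReal.ofReal (|x - y - s| ^ (-lam))) := by
    intro x y
    calc _ = (A * A⁻¹) * (B * B⁻¹) * (f x * h y * ENNReal.ofReal (|x - y - s| ^ (-lam))) := by
          rw [ENNReal.mul_inv_cancel hA0 hAt, ENNReal.mul_inv_cancel hB0 hBt]; simp
      _ = _ := by ring
  have hAB : A * B ≠ ⊤ := ENNReal.mul_ne_top hAt hBt
  simp_rw [E, lintegral_const_mul' _ _ hAB]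
  calc _ ≤ A * B * ENNReal.ofReal C := by gcongr
    _ = _ := by ring

lemma sin_lower (z : ℝ) (h0 : 0 ≤ z) (h1 : z ≤ π) : 2 / π * min z (π - z) ≤ sin z := by
  rcases le_total z (π / 2) with h | h
  · refine le_trans ?_ (Real.mul_le_sin h0 h)
    gcongr; exact min_le_left _ _
  · rw [← Real.sin_pi_sub]
    refine le_trans ?_ (Real.mul_le_sin (by linarith) (by linarith))
    gcongr; exact min_le_right _ _

lemma kernel_bound_pos (lam : ℝ) (h0 : 0 < lam) (z : ℝ) (hz0 : 0 < z) (hz : z < π) :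
    |sin z| ^ (-lam) ≤ (2 / π) ^ (-lam) * (|z| ^ (-lam) + |z - π| ^ (-lam)) := by
  have hs := sin_lower z hz0.le hz.le
  have hpi := Real.pi_pos
  have hmin : 0 < min z (π - z) := lt_min hz0 (by linarith)
  have : |sin z| ^ (-lam) ≤ (2 / π * min z (π - z)) ^ (-lam) :=
    Real.rpow_le_rpow_of_nonpos (by positivity) (hs.trans (le_abs_self _)) (by linarith)
  refine this.trans ?_
  rw [Real.mul_rpow (by positivity) hmin.le]
  gcongr
  rcases min_choice z (π - z) with h | h
  · rw [h, abs_of_pos hz0]; linarith [Real.rpow_nonneg (abs_nonneg (z - π)) (-lam)]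
  · rw [h, abs_sub_comm z π, abs_of_pos (show 0 < π - z by linarith)]
    linarith [Real.rpow_nonneg (abs_nonneg z) (-lam)]

lemma kernel_bound (lam : ℝ) (h0 : 0 < lam) (z : ℝ) (hz0 : z ≠ 0) (hz : |z| < π) :
    |sin z| ^ (-lam) ≤ (2 / π) ^ (-lam) * (|z - 0| ^ (-lam) + |z - π| ^ (-lam) + |z - -π| ^ (-lam)) := by
  have hpi := Real.pi_pos
  rw [abs_lt] at hz
  rw [sub_zero]
  rcases lt_or_gt_of_ne hz0 with h | h
  · have := kernel_bound_pos lam h0 (-z) (by linarith) (by linarith)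
    rw [Real.sin_neg, abs_neg, abs_neg] at this
    refine this.trans ?_
    rw [show |-z - π| = |z - -π| by rw [← abs_neg]; congr 1; ring]
    gcongr
    linarith [Real.rpow_nonneg (abs_nonneg (z - π)) (-lam)]
  · refine (kernel_bound_pos lam h0 z h hz.2).trans ?_
    refine mul_le_mul_of_nonneg_left ?_ (by positivity)
    linarith [Real.rpow_nonneg (abs_nonneg (z - -π)) (-lam)]

end HLS

/-- Revised Hardy–Littlewood–Sobolev inequality on the interval `(-π/2, π/2)`
with kernel `|sin (t - τ)|^(-λ)`. -/
theorem revised_HLS_sin_kernel (lam p q : ℝ) (hlam0 : 0 ≤ lam) (hlam1 : lam < 1)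
    (hp : 1 < p) (hq : 1 < q) (hpq : 1 / p + 1 / q + lam = 2) :
    ∃ C > 0, ∀ g h : ℝ → ℝ, Measurable g → Measurable h →
      (∫⁻ t in Ioo (-(π / 2)) (π / 2), ∫⁻ τ in Ioo (-(π / 2)) (π / 2),
          ENNReal.ofReal (|g t| * |h τ|) / ENNReal.ofReal (|Real.sin (t - τ)| ^ lam))
        ≤ ENNReal.ofReal C
            * eLpNorm g (ENNReal.ofReal p) (volume.restrict (Ioo (-(π / 2)) (π / 2)))
            * eLpNorm h (ENNReal.ofReal q) (volume.restrict (Ioo (-(π / 2)) (π / 2))) := by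
  have hp1 : 1 / p < 1 := by rw [div_lt_one (by linarith)]; exact hp
  have hq1 : 1 / q < 1 := by rw [div_lt_one (by linarith)]; exact hq
  have h0 : 0 < lam := by linarith
  obtain ⟨C, hC, H⟩ := HLS.general lam p q h0 hlam1 hp hq hpq
  have hpi := Real.pi_pos
  set c := (2 / π) ^ (-lam) with hc
  have hc0 : 0 < c := by positivity
  refine ⟨c * (C + C + C), by positivity, fun g h hg hh => ?_⟩
  set I := Ioo (-(π / 2)) (π / 2) with hI
  have hIm : MeasurableSet I := measurableSet_Ioo
  have nrm : ∀ (u : ℝ → ℝ) (r : ℝ), 1 < r →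
      (∫⁻ y, (I.indicator (fun x => ENNReal.ofReal |u x|) y) ^ r) ^ (1 / r)
        = eLpNorm u (ENNReal.ofReal r) (volume.restrict I) := by
    intro u r hr
    rw [eLpNorm_eq_lintegral_rpow_enorm_toReal (by simpa using by linarith) (by simp),
      ENNReal.toReal_ofReal (by linarith), ← lintegral_indicator hIm]
    congr 2; ext y
    by_cases hy : y ∈ I
    · simp [hy, Real.enorm_eq_ofReal_abs]
    · simp [hy, show 0 < r by linarith]
  set f' := I.indicator (fun x => ENNReal.ofReal |g x|) with hf'
  set h' := I.indicator (fun x => ENNReal.ofReal |h x|) with hh'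
  have hfm : Measurable f' := Measurable.indicator (by fun_prop) hIm
  have hhm : Measurable h' := Measurable.indicator (by fun_prop) hIm
  have hft : ∀ x, f' x ≠ ⊤ := fun x => by simp only [hf', indicator]; split_ifs <;> simp
  have hht : ∀ x, h' x ≠ ⊤ := fun x => by simp only [hh', indicator]; split_ifs <;> simp
  have H' := H f' h' hfm hhm hft hht
  rw [nrm g p hp, nrm h q hq] at H'
  set P := eLpNorm g (ENNReal.ofReal p) (volume.restrict I)
  set Q := eLpNorm h (ENNReal.ofReal q) (volume.restrict I)
  set k : ℝ → ℝ → ℝ → ENNReal := fun s x y => f' x * h' y * ENNReal.ofReal (|x - y - s| ^ (-lam)) with hk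
  have hkm : ∀ s, Measurable (fun z : ℝ × ℝ => k s z.1 z.2) := fun s => by simp only [hk]; fun_prop
  have hkx : ∀ s x, Measurable (k s x) := fun s x => (hkm s).comp measurable_prodMk_left
  have hki : ∀ s, Measurable (fun x => ∫⁻ y, k s x y) := fun s => (hkm s).lintegral_prod_right'
  calc _ ≤ ∫⁻ t, ∫⁻ τ, ENNReal.ofReal c * (k 0 t τ + k π t τ + k (-π) t τ) := by
        rw [← lintegral_indicator hIm]
        refine lintegral_mono fun t => ?_
        by_cases ht : t ∈ I
        swap
        · simp [ht]
        rw [indicator_of_mem ht, ← lintegral_indicator hIm]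
        refine lintegral_mono_ae ?_
        have : ∀ᵐ τ : ℝ, τ ≠ t := by simp [ae_iff]
        filter_upwards [this] with τ hτ
        by_cases hτI : τ ∈ I
        swap
        · simp [hτI]
        rw [indicator_of_mem hτI]
        have e1 : f' t = ENNReal.ofReal |g t| := by simp [hf', ht]
        have e2 : h' τ = ENNReal.ofReal |h τ| := by simp [hh', hτI]
        simp only [hk, e1, e2, ← ENNReal.ofReal_mul (abs_nonneg (g t))]
        rw [← mul_add, ← mul_add, ← ENNReal.ofReal_add (by positivity) (by positivity),
          ← ENNReal.ofReal_add (by positivity) (by positivity), mul_left_comm,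
          ← ENNReal.ofReal_mul hc0.le, div_eq_mul_inv]
        gcongr
        have hz0 : t - τ ≠ 0 := sub_ne_zero.2 hτ.symm
        have hzp : |t - τ| < π := by
          rw [abs_lt]; constructor <;> linarith [ht.1, ht.2, hτI.1, hτI.2]
        have hs : sin (t - τ) ≠ 0 := by
          rw [abs_lt] at hzp
          rw [Ne, Real.sin_eq_zero_iff_of_lt_of_lt hzp.1 hzp.2]; exact hz0
        have hs' : 0 < |sin (t - τ)| := abs_pos.2 hs
        rw [← ENNReal.ofReal_inv_of_pos (by positivity), ← Real.rpow_neg hs'.le]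
        exact ENNReal.ofReal_le_ofReal (HLS.kernel_bound lam h0 _ hz0 hzp)
    _ = ENNReal.ofReal c * ((∫⁻ t, ∫⁻ τ, k 0 t τ) + (∫⁻ t, ∫⁻ τ, k π t τ) + ∫⁻ t, ∫⁻ τ, k (-π) t τ) := by
        simp_rw [lintegral_const_mul' _ _ (ENNReal.ofReal_ne_top (r := c))]
        congr 1
        have hk2 : Measurable (fun x => (∫⁻ y, k 0 x y) + ∫⁻ y, k π x y) := (hki 0).add (hki π)
        rw [← lintegral_add_left (hki 0), ← lintegral_add_left hk2]
        refine lintegral_congr fun t => ?_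
        have hk3 : Measurable (fun y => k 0 t y + k π t y) := (hkx 0 t).add (hkx π t)
        rw [lintegral_add_left hk3, lintegral_add_left (hkx 0 t)]
    _ ≤ ENNReal.ofReal c * (ENNReal.ofReal C * P * Q + ENNReal.ofReal C * P * Q + ENNReal.ofReal C * P * Q) := by
        gcongr
        · exact H' 0
        · exact H' π
        · exact H' (-π)
    _ = _ := by
        rw [ENNReal.ofReal_mul hc0.le, ENNReal.ofReal_add (by positivity) (by positivity),
          ENNReal.ofReal_add (by positivity) (by positivity)]
        ring
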